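/- With the same setup (u = χ_{H_θ}, half-plane interface passing through the central cell of a 3×3 unit grid, Sobel responses H_T, V_T), one has |V_T| > |H_T| if and only if θ ∈ [0, π/4) ∪ (3π/4, 5π/4) ∪ (7π/4, 2π), |H_T| > |V_T| if and only if θ ∈ (π/4, 3π/4) ∪ (5π/4, 7π/4), and |H_T| = |V_T| if and only if θ ∈ {π/4, 3π/4, 5π/4, 7π/4}. -/

import Mathlib

open MeasureTheory

/-- The unit cell `T_{i,j}` of a 3×3 grid of unit squares centered at the origin. -/
def unitCell (i j : ℤ) : Set (ℝ × ℝ) :=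
  Set.Icc ((i : ℝ) - 1 / 2) ((i : ℝ) + 1 / 2) ×ˢ Set.Icc ((j : ℝ) - 1 / 2) ((j : ℝ) + 1 / 2)

/-- The area of the part of the unit cell `T_{i,j}` in the half-plane `p x + q y ≤ c`. -/
noncomputable def cellArea (p q c : ℝ) (i j : ℤ) : ℝ :=
  (volume ({z : ℝ × ℝ | p * z.1 + q * z.2 ≤ c} ∩ unitCell i j)).toReal

lemma measurableSet_halfPlane_inter_unitCell (p q c : ℝ) (i j : ℤ) :
    MeasurableSet ({z : ℝ × ℝ | p * z.1 + q * z.2 ≤ c} ∩ unitCell i j) :=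
  (measurableSet_le (by fun_prop) (by fun_prop)).inter (measurableSet_Icc.prod measurableSet_Icc)

lemma volume_inter_unitCell_ne_top (s : Set (ℝ × ℝ)) (i j : ℤ) :
    volume (s ∩ unitCell i j) ≠ ⊤ :=
  measure_ne_top_of_subset Set.inter_subset_right
    (isCompact_Icc.prod isCompact_Icc).measure_lt_top.ne

lemma cellArea_swap (p q c : ℝ) (i j : ℤ) : cellArea p q c i j = cellArea q p c j i := by
  unfold cellArea
  rw [Measure.volume_eq_prod, ← (Measure.measurePreserving_swap (μ := (volume : Measure ℝ))
    (ν := (volume : Measure ℝ))).measure_preimage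
    (measurableSet_halfPlane_inter_unitCell q p c j i).nullMeasurableSet]
  congr 2
  ext ⟨x, y⟩
  simp only [unitCell, Set.mem_inter_iff, Set.mem_ofPred_eq, Set.mem_prod, Set.mem_preimage,
    Prod.swap_prod_mk, add_comm (p * x), and_comm (a := x ∈ _)]

lemma cellArea_reflect (p q c : ℝ) (i j : ℤ) :
    cellArea p q c i j = cellArea p (-q) c i (-j) := by
  unfold cellArea
  rw [Measure.volume_eq_prod, ← ((MeasurePreserving.id (volume : Measure ℝ)).prod
    (Measure.measurePreserving_neg (volume : Measure ℝ))).measure_preimage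
    (measurableSet_halfPlane_inter_unitCell p (-q) c i (-j)).nullMeasurableSet]
  congr 2
  ext ⟨x, y⟩
  simp only [unitCell, Set.mem_inter_iff, Set.mem_ofPred_eq, Set.mem_prod, Set.mem_preimage,
    Prod.map_apply, id_eq, Set.mem_Icc, Int.cast_neg, neg_mul_neg]
  constructor <;> rintro ⟨h, hx, hy⟩ <;> exact ⟨h, hx, by linarith, by linarith⟩

lemma fst_le_snd_of_mem_unitCell {i j : ℤ} (hij : i < j) {z : ℝ × ℝ} (hz : z ∈ unitCell i j) :
    z.1 ≤ z.2 := by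
  have h : (i : ℝ) + 1 ≤ j := by exact_mod_cast hij
  linarith [hz.1.2, hz.2.1]

lemma halfPlane_inter_unitCell_subset {p q : ℝ} (hpq : p ≤ q) (c : ℝ) {i j : ℤ} (hij : i < j) :
    {z : ℝ × ℝ | p * z.1 + q * z.2 ≤ c} ∩ unitCell i j ⊆
      {z : ℝ × ℝ | q * z.1 + p * z.2 ≤ c} ∩ unitCell i j := by
  rintro z ⟨hz, hcell⟩
  have := fst_le_snd_of_mem_unitCell hij hcell
  refine ⟨?_, hcell⟩
  simp only [Set.mem_ofPred_eq] at hz ⊢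
  nlinarith [mul_nonneg (sub_nonneg.2 hpq) (sub_nonneg.2 this)]

lemma cellArea_le {p q : ℝ} (hpq : p ≤ q) (c : ℝ) {i j : ℤ} (hij : i < j) :
    cellArea p q c i j ≤ cellArea q p c i j :=
  ENNReal.toReal_mono (volume_inter_unitCell_ne_top _ _ _)
    (measure_mono (halfPlane_inter_unitCell_subset hpq c hij))

/-- The corner cell `T_{-1,1}` contains a point separated from its mirror image in the diagonal
by any line of slope other than `1` that meets the central cell. -/
lemma exists_separated {p q c : ℝ} (hpq : p < q) (hc : |c| ≤ (|p| + |q|) / 2) :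
    ∃ t ∈ Set.Icc (-1 / 2 : ℝ) (1 / 2),
      c < p * (t - 1) + q * (t + 1) ∧ q * (t - 1) + p * (t + 1) < c := by
  rw [abs_le] at hc
  rcases lt_or_ge 0 p with hp | hp
  · rw [abs_of_pos hp, abs_of_pos (hp.trans hpq)] at hc
    have hs : 0 < p + q := by linarith
    have ht : (p + q) * (c / (p + q)) = c := by field_simp
    refine ⟨c / (p + q), ⟨?_, ?_⟩, by linarith, by linarith⟩
    · rw [le_div_iff₀ hs]; linarith
    · rw [div_le_iff₀ hs]; linarith
  · rcases lt_or_ge q 0 with hq | hq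
    · rw [abs_of_neg hq, abs_of_nonpos hp] at hc
      have hs : p + q < 0 := by linarith
      have ht : (p + q) * (c / (p + q)) = c := mul_div_cancel₀ c hs.ne
      refine ⟨c / (p + q), ⟨?_, ?_⟩, by linarith, by linarith⟩
      · rw [le_div_iff_of_neg hs]; linarith
      · rw [div_le_iff_of_neg hs]; linarith
    · rw [abs_of_nonneg hq, abs_of_nonpos hp] at hc
      exact ⟨0, by norm_num, by linarith, by linarith⟩

lemma cellArea_lt {p q c : ℝ} (hpq : p < q) (hc : |c| ≤ (|p| + |q|) / 2) :
    cellArea p q c (-1) 1 < cellArea q p c (-1) 1 := by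
  obtain ⟨t, ht, h₁, h₂⟩ := exists_separated hpq hc
  let U : Set (ℝ × ℝ) := {z | c < p * z.1 + q * z.2} ∩ {z | q * z.1 + p * z.2 < c}
  have hUo : IsOpen U :=
    (isOpen_lt (by fun_prop) (by fun_prop)).inter (isOpen_lt (by fun_prop) (by fun_prop))
  have hmem : (t - 1, t + 1) ∈ closure (interior (unitCell (-1) 1)) := by
    rw [unitCell, interior_prod_eq, interior_Icc, interior_Icc, closure_prod_eq,
      closure_Ioo (by norm_num), closure_Ioo (by norm_num)]
    push_cast
    constructor <;> constructor <;> linarith [ht.1, ht.2]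
  have hne : (U ∩ interior (unitCell (-1) 1)).Nonempty :=
    mem_closure_iff.1 hmem U hUo ⟨h₁, h₂⟩
  have hpos := (hUo.inter isOpen_interior).measure_pos (volume : Measure (ℝ × ℝ)) hne
  refine ENNReal.toReal_strict_mono (volume_inter_unitCell_ne_top _ _ _) ?_
  rw [← tsub_pos_iff_lt, ← measure_sdiff (halfPlane_inter_unitCell_subset hpq.le c (by norm_num))
    (measurableSet_halfPlane_inter_unitCell p q c (-1) 1).nullMeasurableSet
    (volume_inter_unitCell_ne_top _ _ _)]
  refine hpos.trans_le (measure_mono ?_)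
  rintro z ⟨⟨hz₁, hz₂⟩, hz⟩
  rw [Set.mem_ofPred_eq] at hz₁ hz₂
  exact ⟨⟨Set.mem_ofPred.2 hz₂.le, interior_subset hz⟩, fun h => hz₁.not_ge h.1⟩

/-- The total area of the half-plane `p x + q y ≤ c` in the three cells above the diagonal minus
that in the three cells below it. -/
noncomputable def diagonalDiff (p q c : ℝ) : ℝ :=
  (cellArea p q c 0 1 - cellArea p q c 1 0) + (cellArea p q c (-1) 1 - cellArea p q c 1 (-1)) +
    (cellArea p q c (-1) 0 - cellArea p q c 0 (-1))

lemma diagonalDiff_swap (p q c : ℝ) : diagonalDiff q p c = -diagonalDiff p q c := by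
  simp only [diagonalDiff, cellArea_swap q p]
  ring

lemma diagonalDiff_neg {p q c : ℝ} (hpq : p < q) (hc : |c| ≤ (|p| + |q|) / 2) :
    diagonalDiff p q c < 0 := by
  rw [diagonalDiff, cellArea_swap p q c 1 0, cellArea_swap p q c 1 (-1),
    cellArea_swap p q c 0 (-1)]
  linarith [cellArea_lt hpq hc, cellArea_le hpq.le c (i := 0) (j := 1) (by norm_num),
    cellArea_le hpq.le c (i := -1) (j := 0) (by norm_num)]

lemma sign_diagonalDiff {p q c : ℝ} (hc : |c| ≤ (|p| + |q|) / 2) :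
    SignType.sign (diagonalDiff p q c) = SignType.sign (p - q) := by
  rcases lt_trichotomy p q with h | rfl | h
  · rw [sign_neg (diagonalDiff_neg h hc), sign_neg (sub_neg.2 h)]
  · have : diagonalDiff p p c = 0 := by linarith [diagonalDiff_swap p p c]
    rw [this, sub_self]
  · have := diagonalDiff_neg h (by rwa [add_comm])
    rw [diagonalDiff_swap, neg_lt_zero] at this
    rw [sign_pos this, sign_pos (sub_pos.2 h)]

/-- The squares of the Sobel responses compare like the squares of the components of the normal
vector. -/
lemma sign_sobel_sq_sub_sq {p q c : ℝ} (hc : |c| ≤ (|p| + |q|) / 2) :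
    let a := cellArea p q c
    let V : ℝ := 2 * a 0 1 + a 1 1 + a (-1) 1 - 2 * a 0 (-1) - a 1 (-1) - a (-1) (-1)
    let Ht : ℝ := 2 * a 1 0 + a 1 1 + a 1 (-1) - 2 * a (-1) 0 - a (-1) 1 - a (-1) (-1)
    SignType.sign (V ^ 2 - Ht ^ 2) = SignType.sign (q ^ 2 - p ^ 2) := by
  intro a V Ht
  have h₁ : V - Ht = 2 * diagonalDiff p q c := by
    simp only [V, Ht, a, diagonalDiff]; ring
  have h₂ : V + Ht = 2 * -diagonalDiff p (-q) c := by
    simp only [V, Ht, a, diagonalDiff, cellArea_reflect p (-q), neg_neg, neg_zero]; ring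
  rw [show V ^ 2 - Ht ^ 2 = (V - Ht) * (V + Ht) by ring, h₁, h₂,
    show q ^ 2 - p ^ 2 = (p - q) * -(p - -q) by ring]
  simp only [sign_mul, Left.sign_neg, sign_diagonalDiff hc,
    sign_diagonalDiff (p := p) (q := -q) (c := c) (by rwa [abs_neg]),
    sign_pos (zero_lt_two' ℝ), one_mul]

lemma abs_mul_add_mul_le (p q : ℝ) {z : ℝ × ℝ} (hz : z ∈ unitCell 0 0) :
    |p * z.1 + q * z.2| ≤ (|p| + |q|) / 2 := by
  simp only [unitCell, Set.mem_prod, Set.mem_Icc, Int.cast_zero] at hz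
  have h₁ : |z.1| ≤ 1 / 2 := abs_le.2 ⟨by linarith, by linarith⟩
  have h₂ : |z.2| ≤ 1 / 2 := abs_le.2 ⟨by linarith, by linarith⟩
  calc |p * z.1 + q * z.2| ≤ |p| * |z.1| + |q| * |z.2| := by
        simpa only [abs_mul] using abs_add_le (p * z.1) (q * z.2)
    _ ≤ |p| * (1 / 2) + |q| * (1 / 2) := by gcongr
    _ = (|p| + |q|) / 2 := by ring

lemma cos_two_mul_pos {θ : ℝ} (hθ : θ ∈ Set.Ico 0 (Real.pi / 4) ∪
    Set.Ioo (3 * Real.pi / 4) (5 * Real.pi / 4) ∪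
    Set.Ioo (7 * Real.pi / 4) (2 * Real.pi)) : 0 < Real.cos (2 * θ) := by
  have hpi := Real.pi_pos
  rcases hθ with (⟨h₁, h₂⟩ | ⟨h₁, h₂⟩) | ⟨h₁, h₂⟩
  · exact Real.cos_pos_of_mem_Ioo ⟨by linarith, by linarith⟩
  · rw [← Real.cos_sub_two_pi]
    exact Real.cos_pos_of_mem_Ioo ⟨by linarith, by linarith⟩
  · rw [← Real.cos_sub_two_pi, ← Real.cos_sub_two_pi]
    exact Real.cos_pos_of_mem_Ioo ⟨by linarith, by linarith⟩

lemma cos_two_mul_neg {θ : ℝ} (hθ : θ ∈ Set.Ioo (Real.pi / 4) (3 * Real.pi / 4) ∪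
    Set.Ioo (5 * Real.pi / 4) (7 * Real.pi / 4)) : Real.cos (2 * θ) < 0 := by
  rcases hθ with ⟨h₁, h₂⟩ | ⟨h₁, h₂⟩
  · exact Real.cos_neg_of_pi_div_two_lt_of_lt (by linarith) (by linarith)
  · rw [← Real.cos_sub_two_pi]
    exact Real.cos_neg_of_pi_div_two_lt_of_lt (by linarith) (by linarith)

lemma cos_two_mul_eq_zero {θ : ℝ} (hθ : θ ∈ ({Real.pi / 4, 3 * Real.pi / 4, 5 * Real.pi / 4,
    7 * Real.pi / 4} : Set ℝ)) : Real.cos (2 * θ) = 0 := by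
  rw [Real.cos_eq_zero_iff]
  rcases hθ with rfl | rfl | rfl | rfl
  · exact ⟨0, by push_cast; ring⟩
  · exact ⟨1, by push_cast; ring⟩
  · exact ⟨2, by push_cast; ring⟩
  · exact ⟨3, by push_cast; ring⟩

lemma mem_union_of_mem_Ico {θ : ℝ} (hθ : θ ∈ Set.Ico 0 (2 * Real.pi)) :
    θ ∈ Set.Ico 0 (Real.pi / 4) ∪ Set.Ioo (3 * Real.pi / 4) (5 * Real.pi / 4) ∪
        Set.Ioo (7 * Real.pi / 4) (2 * Real.pi) ∨
      θ ∈ Set.Ioo (Real.pi / 4) (3 * Real.pi / 4) ∪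
        Set.Ioo (5 * Real.pi / 4) (7 * Real.pi / 4) ∨
      θ ∈ ({Real.pi / 4, 3 * Real.pi / 4, 5 * Real.pi / 4, 7 * Real.pi / 4} : Set ℝ) := by
  simp only [Set.mem_union, Set.mem_Ico, Set.mem_Ioo, Set.mem_insert_iff,
    Set.mem_singleton_iff] at hθ ⊢
  grind

/-- Comparison of the Sobel responses for a half-plane interface through the central cell:
for `u = χ_{H_θ}` with `H_θ = {⟨z − z₀, e_θ⟩ ≤ 0}`, `e_θ = (−sin θ, cos θ)`, `z₀` in the
central unit cell, one has `|V_T| > |H_T|` iff `θ ∈ [0,π/4) ∪ (3π/4,5π/4) ∪ (7π/4,2π)`,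
`|H_T| > |V_T|` iff `θ ∈ (π/4,3π/4) ∪ (5π/4,7π/4)`, and `|H_T| = |V_T|` iff
`θ ∈ {π/4, 3π/4, 5π/4, 7π/4}`. -/
theorem stmt18 (z0 : ℝ × ℝ) (hz0 : z0 ∈ unitCell 0 0)
    (θ : ℝ) (hθ : θ ∈ Set.Ico 0 (2 * Real.pi)) :
    let Hset : Set (ℝ × ℝ) :=
      {z : ℝ × ℝ | (z.1 - z0.1) * (-Real.sin θ) + (z.2 - z0.2) * Real.cos θ ≤ 0}
    let a : ℤ → ℤ → ℝ := fun i j => (volume (Hset ∩ unitCell i j)).toReal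
    let V : ℝ := 2 * a 0 1 + a 1 1 + a (-1) 1 - 2 * a 0 (-1) - a 1 (-1) - a (-1) (-1)
    let Ht : ℝ := 2 * a 1 0 + a 1 1 + a 1 (-1) - 2 * a (-1) 0 - a (-1) 1 - a (-1) (-1)
    (|Ht| < |V| ↔ θ ∈ Set.Ico 0 (Real.pi / 4) ∪
        Set.Ioo (3 * Real.pi / 4) (5 * Real.pi / 4) ∪
        Set.Ioo (7 * Real.pi / 4) (2 * Real.pi)) ∧
    (|V| < |Ht| ↔ θ ∈ Set.Ioo (Real.pi / 4) (3 * Real.pi / 4) ∪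
        Set.Ioo (5 * Real.pi / 4) (7 * Real.pi / 4)) ∧
    (|Ht| = |V| ↔ θ ∈ ({Real.pi / 4, 3 * Real.pi / 4, 5 * Real.pi / 4, 7 * Real.pi / 4}
        : Set ℝ)) := by
  intro Hset a V Ht
  have ha : a = cellArea (-Real.sin θ) (Real.cos θ)
      (-Real.sin θ * z0.1 + Real.cos θ * z0.2) := by
    funext i j
    simp only [a, cellArea, Hset]
    congr 4
    ext z
    constructor <;> intro h <;> linarith
  have hsign : SignType.sign (V ^ 2 - Ht ^ 2) = SignType.sign (Real.cos (2 * θ)) := by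
    have h := sign_sobel_sq_sub_sq (abs_mul_add_mul_le (-Real.sin θ) (Real.cos θ) hz0)
    rw [← ha, neg_sq, ← Real.cos_two_mul'] at h
    exact h
  have hlt : |Ht| < |V| ↔ 0 < Real.cos (2 * θ) := by
    rw [← sq_lt_sq, ← sub_pos, ← sign_eq_one_iff, hsign, sign_eq_one_iff]
  have hgt : |V| < |Ht| ↔ Real.cos (2 * θ) < 0 := by
    rw [← sq_lt_sq, ← sub_neg, ← sign_eq_neg_one_iff, hsign, sign_eq_neg_one_iff]
  have heq : |Ht| = |V| ↔ Real.cos (2 * θ) = 0 := by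
    rw [eq_comm, ← sq_eq_sq_iff_abs_eq_abs, ← sub_eq_zero, ← sign_eq_zero_iff, hsign,
      sign_eq_zero_iff]
  rw [hlt, hgt, heq]
  have hcover := mem_union_of_mem_Ico hθ
  refine ⟨⟨fun h => ?_, cos_two_mul_pos⟩, ⟨fun h => ?_, cos_two_mul_neg⟩,
    ⟨fun h => ?_, cos_two_mul_eq_zero⟩⟩
  · exact hcover.resolve_right fun h' => h'.elim (fun h' => (cos_two_mul_neg h').not_gt h)
      fun h' => h.ne' (cos_two_mul_eq_zero h')
  · exact (hcover.resolve_left fun h' => (cos_two_mul_pos h').not_gt h).resolve_right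
      fun h' => h.ne (cos_two_mul_eq_zero h')
  · exact (hcover.resolve_left fun h' => (cos_two_mul_pos h').ne' h).resolve_left
      fun h' => (cos_two_mul_neg h').ne h
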